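/- Let P ⊆ M ⊆ L be Lie subalgebras of L with P abelian. Then the following are equivalent: (1) P is a CP of L; (2) P is a CP of M and i(M) = i(L) + dim L − dim M. Moreover, under these equivalent conditions, for every regular f ∈ L* the restriction of f to M is a regular element of M*. -/

import Mathlib

open Module

noncomputable section

variable (k : Type*) [Field k]

/-- `L(f) = {x ∈ L | f ⁅x, y⁆ = 0 for all y ∈ L}`. -/
def lieStab (L : Type*) [LieRing L] [LieAlgebra k L] (f : Module.Dual k L) :
    Submodule k L where
  carrier := {x | ∀ y : L, f ⁅x, y⁆ = 0}
  add_mem' := fun {a b} ha hb y => by rw [add_lie, map_add, ha y, hb y, add_zero]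
  zero_mem' := fun y => by rw [zero_lie, map_zero]
  smul_mem' := fun c a ha y => by rw [smul_lie, map_smul, ha y, smul_zero]

/-- The index `i(L)`, the minimum of `dim L(f)` over all `f ∈ L*`. -/
def lieIndex (L : Type*) [LieRing L] [LieAlgebra k L] : ℕ :=
  ⨅ f : Module.Dual k L, finrank k (lieStab k L f)

/-- `f ∈ L*` is regular if `dim L(f) = i(L)`. -/
def LieIsRegular (L : Type*) [LieRing L] [LieAlgebra k L] (f : Module.Dual k L) : Prop :=
  finrank k (lieStab k L f) = lieIndex k L

/-- A commutative polarization of `L`: an abelian Lie subalgebra `P` with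
`2 dim P = dim L + i(L)`. -/
def IsCP (L : Type*) [LieRing L] [LieAlgebra k L] (P : LieSubalgebra k L) : Prop :=
  IsLieAbelian ↥P ∧ 2 * finrank k ↥P = finrank k L + lieIndex k L

/-- A CP-ideal of `L`: a CP which is also a Lie ideal of `L`. -/
def IsCPIdeal (L : Type*) [LieRing L] [LieAlgebra k L] (P : LieSubalgebra k L) : Prop :=
  IsCP k L P ∧ ∀ x y : L, y ∈ P → ⁅x, y⁆ ∈ P

/-- `L` is square integrable if `i(L) = dim Z(L)`. -/
def SquareIntegrable (L : Type*) [LieRing L] [LieAlgebra k L] : Prop :=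
  lieIndex k L = finrank k ↥(LieAlgebra.center k L)


/-- The alternating form `(x, y) ↦ f ⁅x, y⁆` attached to `f ∈ L*`. -/
def lieForm {k L : Type*} [Field k] [LieRing L] [LieAlgebra k L] (f : Module.Dual k L) :
    LinearMap.BilinForm k L :=
  LinearMap.mk₂ k (fun x y => f ⁅x, y⁆) (fun x y z => by rw [add_lie, map_add])
    (fun c x y => by rw [smul_lie, map_smul]) (fun x y z => by rw [lie_add, map_add])
    (fun c x y => by rw [lie_smul, map_smul])

lemma lieForm_apply {k L : Type*} [Field k] [LieRing L] [LieAlgebra k L]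
    (f : Module.Dual k L) (x y : L) : lieForm f x y = f ⁅x, y⁆ := rfl

lemma lieForm_isRefl {k L : Type*} [Field k] [LieRing L] [LieAlgebra k L]
    (f : Module.Dual k L) : (lieForm f).IsRefl := fun x y h => by
  rw [lieForm_apply] at h ⊢
  rw [← lie_skew, map_neg, h, neg_zero]

lemma lieForm_orthogonal_top {k L : Type*} [Field k] [LieRing L] [LieAlgebra k L]
    (f : Module.Dual k L) : (lieForm f).orthogonal ⊤ = lieStab k L f := by
  ext x
  exact ⟨fun h y => lieForm_isRefl f y x (h y trivial),
    fun h y _ => lieForm_isRefl f x y (h y)⟩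

lemma finrank_add_finrank_lieForm_orthogonal {k L : Type*} [Field k] [LieRing L]
    [LieAlgebra k L] [FiniteDimensional k L] (f : Module.Dual k L) (W : Submodule k L) :
    finrank k W + finrank k ((lieForm f).orthogonal W) =
      finrank k L + finrank k (W ⊓ lieStab k L f : Submodule k L) := by
  rw [LinearMap.BilinForm.finrank_add_finrank_orthogonal (lieForm_isRefl f),
    lieForm_orthogonal_top]

lemma le_lieForm_orthogonal {k L : Type*} [Field k] [LieRing L] [LieAlgebra k L]
    (f : Module.Dual k L) (P : LieSubalgebra k L) [IsLieAbelian P] :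
    P.toSubmodule ≤ (lieForm f).orthogonal P.toSubmodule := fun x hx y hy => by
  have h : ⁅(⟨y, hy⟩ : P), (⟨x, hx⟩ : P)⁆ = 0 := trivial_lie_zero _ _ _ _
  rw [lieForm_apply, show ⁅y, x⁆ = 0 from congrArg Subtype.val h, map_zero]

/-- An abelian subalgebra is totally isotropic for every `f`, which bounds its dimension. -/
lemma two_mul_finrank_le {k L : Type*} [Field k] [LieRing L] [LieAlgebra k L]
    [FiniteDimensional k L] (f : Module.Dual k L) (P : LieSubalgebra k L) [IsLieAbelian P] :
    2 * finrank k P ≤ finrank k L + finrank k (lieStab k L f) := by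
  have h₁ : finrank k P ≤ _ := Submodule.finrank_mono (le_lieForm_orthogonal f P)
  have h₂ : finrank k P + _ = _ := finrank_add_finrank_lieForm_orthogonal f P.toSubmodule
  have h₃ := Submodule.finrank_mono (inf_le_right : P.toSubmodule ⊓ lieStab k L f ≤ _)
  lia

/-- Equality holds in `two_mul_finrank_le` exactly when `P` is its own orthogonal. -/
lemma two_mul_finrank_eq_iff {k L : Type*} [Field k] [LieRing L] [LieAlgebra k L]
    [FiniteDimensional k L] (f : Module.Dual k L) (P : LieSubalgebra k L) [IsLieAbelian P] :
    2 * finrank k P = finrank k L + finrank k (lieStab k L f) ↔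
      (lieForm f).orthogonal P.toSubmodule ≤ P.toSubmodule := by
  have h₁ := le_lieForm_orthogonal f P
  have h₂ : finrank k P + _ = _ := finrank_add_finrank_lieForm_orthogonal f P.toSubmodule
  have h₃ := Submodule.finrank_mono (inf_le_right : P.toSubmodule ⊓ lieStab k L f ≤ _)
  constructor
  · intro h
    refine (Submodule.eq_of_le_of_finrank_le h₁ ?_).ge
    change _ ≤ finrank k P
    lia
  · intro h
    have h₄ : lieStab k L f ≤ P.toSubmodule := by
      rw [← lieForm_orthogonal_top]
      exact (LinearMap.BilinForm.orthogonal_le le_top).trans h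
    rw [inf_eq_right.mpr h₄, le_antisymm h h₁] at h₂
    change finrank k P + finrank k P = _ at h₂
    lia

lemma exists_lieIsRegular (k L : Type*) [Field k] [LieRing L] [LieAlgebra k L] :
    ∃ f : Module.Dual k L, LieIsRegular k L f :=
  Nat.sInf_mem (Set.range_nonempty fun f : Module.Dual k L => finrank k (lieStab k L f))

lemma lieIndex_le {k L : Type*} [Field k] [LieRing L] [LieAlgebra k L]
    (f : Module.Dual k L) : lieIndex k L ≤ finrank k (lieStab k L f) :=
  ciInf_le (OrderBot.bddBelow _) f

lemma two_mul_finrank_le_add_lieIndex {k L : Type*} [Field k] [LieRing L] [LieAlgebra k L]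
    [FiniteDimensional k L] (P : LieSubalgebra k L) [IsLieAbelian P] :
    2 * finrank k P ≤ finrank k L + lieIndex k L := by
  obtain ⟨f, hf⟩ := exists_lieIsRegular k L
  exact hf ▸ two_mul_finrank_le f P

lemma finrank_comap_incl {k L : Type*} [Field k] [LieRing L] [LieAlgebra k L]
    {P M : LieSubalgebra k L} (hPM : P ≤ M) :
    finrank k (LieSubalgebra.comap M.incl P) = finrank k P :=
  (Submodule.comapSubtypeEquivOfLe (p := P.toSubmodule) (q := M.toSubmodule) hPM).finrank_eq

lemma isLieAbelian_comap_incl {k L : Type*} [Field k] [LieRing L] [LieAlgebra k L]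
    (P M : LieSubalgebra k L) [IsLieAbelian P] :
    IsLieAbelian (LieSubalgebra.comap M.incl P) where
  trivial x y := by
    have h : ⁅(⟨x.1.1, x.2⟩ : P), (⟨y.1.1, y.2⟩ : P)⁆ = 0 := trivial_lie_zero _ _ _ _
    exact Subtype.ext (Subtype.ext (congrArg (Subtype.val : P → L) h :))

/-- The dimension of the stabilizer of the restriction to `M` of a regular form, when `M`
contains a commutative polarization of `L`. -/
lemma IsCP.two_mul_finrank_eq_of_le {k L : Type*} [Field k] [LieRing L] [LieAlgebra k L]
    [FiniteDimensional k L] {P M : LieSubalgebra k L} (hPM : P ≤ M) (hP : IsCP k L P)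
    {f : Module.Dual k L} (hf : LieIsRegular k L f) :
    2 * finrank k P =
      finrank k M + finrank k (lieStab k M (f.comp M.incl.toLinearMap)) := by
  have := hP.1
  have := isLieAbelian_comap_incl P M
  have h := (two_mul_finrank_eq_iff f P).1 (by rw [hP.2, hf])
  rw [← finrank_comap_incl hPM, two_mul_finrank_eq_iff]
  exact fun x hx => h fun y hy => hx ⟨y, hPM hy⟩ hy

/-- **Lemma 1.3.** Let `P ⊆ M ⊆ L` be Lie subalgebras with `P` abelian.  Then `P` is a CP of `L`
iff `P` is a CP of `M` and `i(M) = i(L) + dim L - dim M`; and under these conditions the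
restriction to `M` of any regular `f ∈ L*` is regular for `M`. -/
theorem cp_of_subalgebra_iff {k L : Type*} [Field k] [CharZero k] [LieRing L]
    [LieAlgebra k L] [FiniteDimensional k L] (P M : LieSubalgebra k L) (hPM : P ≤ M)
    (hP : IsLieAbelian ↥P) :
    (IsCP k L P ↔
      IsCP k ↥M (LieSubalgebra.comap M.incl P) ∧
        lieIndex k ↥M + finrank k ↥M = lieIndex k L + finrank k L) ∧
    (IsCP k L P → ∀ f : Module.Dual k L, LieIsRegular k L f →
      LieIsRegular k ↥M (f.comp M.incl.toLinearMap)) := by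
  have := isLieAbelian_comap_incl P M
  have hle := two_mul_finrank_le_add_lieIndex (LieSubalgebra.comap M.incl P)
  have hdim := finrank_comap_incl hPM
  refine ⟨⟨fun h => ?_, fun ⟨h, h'⟩ => ⟨hP, ?_⟩⟩, fun h f hf => ?_⟩
  · obtain ⟨f, hf⟩ := exists_lieIsRegular k L
    have h₁ := h.two_mul_finrank_eq_of_le hPM hf
    have h₂ := lieIndex_le (f.comp M.incl.toLinearMap)
    have h₃ := h.2
    exact ⟨⟨inferInstance, by lia⟩, by lia⟩
  · have h₁ := h.2
    lia
  · have h₁ := h.two_mul_finrank_eq_of_le hPM hf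
    have h₂ := lieIndex_le (f.comp M.incl.toLinearMap)
    unfold LieIsRegular
    lia

end
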